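/- arXiv:0910.0170 — 5 statements merged into one kernel-verified Lean document; each statement's English description precedes it below -/
import Mathlib

section
/- Let J ⊆ ℝ be an open interval on which sin(4s) ≠ 0, let h : J → ℝ be differentiable with h(s) > 0 for every s ∈ J, and let α : J → ℝ be differentiable and satisfy the first-order equation α'(s) = 4 h(s) sin(α(s)) / sin(4s) for all s ∈ J. Then α is twice differentiable on J and satisfies the second-order equation α''(s) + [4 cos(4s)/sin(4s) − h'(s)/h(s)] α'(s) − (16 h(s)²/sin²(4s)) sin(α(s)) cos(α(s)) = 0 for all s ∈ J. -/
open Real Set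

/-- The first-order (horizontal conformality) equation is a prime integral of the
second-order (harmonicity) equation: any solution of the first-order ODE is twice
differentiable and solves the second-order ODE. -/
theorem prime_integral (a b : ℝ) (h h' α : ℝ → ℝ)
    (hsin : ∀ s ∈ Ioo a b, sin (4 * s) ≠ 0)
    (hpos : ∀ s ∈ Ioo a b, 0 < h s)
    (hder : ∀ s ∈ Ioo a b, HasDerivAt h (h' s) s)
    (hα : ∀ s ∈ Ioo a b, HasDerivAt α (4 * h s * sin (α s) / sin (4 * s)) s) :
    ∀ s ∈ Ioo a b,
      HasDerivAt (deriv α)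
        (-(4 * cos (4 * s) / sin (4 * s) - h' s / h s) * deriv α s
          + 16 * (h s) ^ 2 / sin (4 * s) ^ 2 * sin (α s) * cos (α s)) s := by
  intro s hs
  have hS := hsin s hs
  have hh := (hpos s hs).ne'
  have hEq : deriv α =ᶠ[nhds s] fun t => 4 * h t * sin (α t) / sin (4 * t) := by
    filter_upwards [isOpen_Ioo.mem_nhds hs] with t ht using (hα t ht).deriv
  have hlin : HasDerivAt (fun t : ℝ => 4 * t) 4 s := by
    simpa using (hasDerivAt_id s).const_mul 4
  have hquot := (((hder s hs).const_mul 4).mul (hα s hs).sin).div hlin.sin hS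
  refine (hquot.congr_of_eventuallyEq hEq).congr_deriv ?_
  rw [(hα s hs).deriv]
  simp only [Pi.mul_apply]
  field_simp
  ring
end

section
/- Let a₁, a₂, a₃, a₄ be positive real numbers, define h(s) = √(a₁² cos²s + a₂² cos²(s+π/4) + a₃² sin²s + a₄² sin²(s+π/4)), let F(s) = ∫_{π/8}^{s} 4 h(u)/sin(4u) du for s ∈ (0,π/4), and for c > 0 let α_c(s) = 2 arctan(c·exp(F(s))). Then lim_{s→0⁺} α_c(s) = 0 and lim_{s→(π/4)⁻} α_c(s) = π. -/
open Real Set Filter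

/-- A function dominating a positive multiple of `1 / (u - a)` has divergent integral at `a⁺`. -/
theorem tendsto_integral_nhdsGT_atTop_of_div_sub_le {f : ℝ → ℝ} {a b p m : ℝ} (hm : 0 < m)
    (hp : p ∈ Ioo a b) (hf : ContinuousOn f (Ioo a b))
    (hle : ∀ u ∈ Ioo a b, m / (u - a) ≤ f u) :
    Tendsto (fun s => ∫ u in s..p, f u) (nhdsWithin a (Ioi a)) atTop := by
  have hlog : Tendsto (fun s => m * (log (p - a) - log (s - a)))
      (nhdsWithin a (Ioi a)) atTop := by
    have hsub : Tendsto (fun s => s - a) (nhdsWithin a (Ioi a)) (nhdsWithin 0 (Ioi 0)) := by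
      refine tendsto_nhdsWithin_iff.2 ⟨?_, ?_⟩
      · have : Tendsto (fun s => s - a) (nhds a) (nhds (a - a)) :=
          (continuous_id.sub continuous_const).tendsto a
        rw [sub_self] at this
        exact this.mono_left nhdsWithin_le_nhds
      · filter_upwards [self_mem_nhdsWithin] with s hs using sub_pos.2 (mem_Ioi.1 hs)
    have hneg := tendsto_neg_atBot_atTop.comp (tendsto_log_nhdsGT_zero.comp hsub)
    exact (tendsto_atTop_add_const_left _ (log (p - a)) hneg).const_mul_atTop hm
  refine tendsto_atTop_mono' _ ?_ hlog
  filter_upwards [Ioo_mem_nhdsGT hp.1] with s hs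
  have hsub : Icc s p ⊆ Ioo a b := Icc_subset_Ioo hs.1 hp.2
  have hint : ∫ u in s..p, m / (u - a) = m * (log (p - a) - log (s - a)) := by
    have hs' := sub_pos.2 hs.1
    have hp' := sub_pos.2 hp.1
    simp only [div_eq_mul_inv, intervalIntegral.integral_const_mul]
    rw [intervalIntegral.integral_comp_sub_right (fun u => u⁻¹) a,
      integral_inv_of_pos hs' hp', log_div hp'.ne' hs'.ne']
  rw [← hint]
  refine intervalIntegral.integral_mono_on hs.2.le ?_ ?_ fun u hu => hle u (hsub hu)
  · refine ContinuousOn.intervalIntegrable_of_Icc hs.2.le ?_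
    exact continuousOn_const.div (continuousOn_id.sub continuousOn_const)
      fun u hu => (sub_pos.2 (hsub hu).1).ne'
  · exact (hf.mono hsub).intervalIntegrable_of_Icc hs.2.le

/-- A function dominating a positive multiple of `1 / (b - u)` has divergent integral at `b⁻`. -/
theorem tendsto_integral_nhdsLT_atTop_of_div_sub_le {f : ℝ → ℝ} {a b p m : ℝ} (hm : 0 < m)
    (hp : p ∈ Ioo a b) (hf : ContinuousOn f (Ioo a b))
    (hle : ∀ u ∈ Ioo a b, m / (b - u) ≤ f u) :
    Tendsto (fun s => ∫ u in p..s, f u) (nhdsWithin b (Iio b)) atTop := by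
  have hmaps : ∀ u ∈ Ioo (-b) (-a), -u ∈ Ioo a b :=
    fun u hu => ⟨lt_neg_of_lt_neg hu.2, neg_lt_of_neg_lt hu.1⟩
  have key := tendsto_integral_nhdsGT_atTop_of_div_sub_le (f := fun u => f (-u)) (a := -b)
    (b := -a) (p := -p) hm ⟨neg_lt_neg hp.2, neg_lt_neg hp.1⟩
    (hf.comp continuousOn_neg hmaps) fun u hu => by
      have := hle (-u) (hmaps u hu)
      rwa [sub_neg_eq_add, add_comm, ← sub_neg_eq_add] at this
  simpa [Function.comp_def] using key.comp tendsto_neg_nhdsLT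

theorem min_le_sqrt_of_cos_sq_sin_sq {a₁ a₃ : ℝ} (a₂ a₄ s t : ℝ) (ha₁ : 0 < a₁) (ha₃ : 0 < a₃) :
    min a₁ a₃ ≤ √(a₁ ^ 2 * cos s ^ 2 + a₂ ^ 2 * cos t ^ 2
      + a₃ ^ 2 * sin s ^ 2 + a₄ ^ 2 * sin t ^ 2) := by
  have hm : 0 ≤ min a₁ a₃ := (lt_min ha₁ ha₃).le
  apply le_sqrt_of_sq_le
  calc min a₁ a₃ ^ 2 = min a₁ a₃ ^ 2 * cos s ^ 2 + min a₁ a₃ ^ 2 * sin s ^ 2 := by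
        rw [← mul_add, cos_sq_add_sin_sq, mul_one]
    _ ≤ a₁ ^ 2 * cos s ^ 2 + a₃ ^ 2 * sin s ^ 2 := by
        gcongr
        · exact min_le_left _ _
        · exact min_le_right _ _
    _ ≤ _ := by
        have := mul_nonneg (sq_nonneg a₂) (sq_nonneg (cos t))
        have := mul_nonneg (sq_nonneg a₄) (sq_nonneg (sin t))
        linarith

theorem boundary_limits (a₁ a₂ a₃ a₄ : ℝ)
    (ha₁ : 0 < a₁) (ha₂ : 0 < a₂) (ha₃ : 0 < a₃) (ha₄ : 0 < a₄)
    (h : ℝ → ℝ)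
    (hh : ∀ s : ℝ, h s = Real.sqrt (a₁ ^ 2 * cos s ^ 2 + a₂ ^ 2 * cos (s + π / 4) ^ 2
      + a₃ ^ 2 * sin s ^ 2 + a₄ ^ 2 * sin (s + π / 4) ^ 2))
    (F : ℝ → ℝ)
    (hF : ∀ s ∈ Ioo (0 : ℝ) (π / 4), F s = ∫ u in (π / 8)..s, 4 * h u / sin (4 * u))
    (c : ℝ) (hc : 0 < c)
    (α : ℝ → ℝ)
    (hα : ∀ s ∈ Ioo (0 : ℝ) (π / 4), α s = 2 * arctan (c * Real.exp (F s))) :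
    Tendsto α (nhdsWithin 0 (Ioi 0)) (nhds 0) ∧
      Tendsto α (nhdsWithin (π / 4) (Iio (π / 4))) (nhds π) := by
  have hπ := pi_pos
  have hm : 0 < min a₁ a₃ := lt_min ha₁ ha₃
  have hlow : ∀ u, min a₁ a₃ ≤ h u := fun u => by
    rw [hh]
    exact min_le_sqrt_of_cos_sq_sin_sq a₂ a₄ u (u + π / 4) ha₁ ha₃
  have hcont : Continuous h := by
    rw [funext hh]
    fun_prop
  have hsin : ∀ u ∈ Ioo (0 : ℝ) (π / 4), 0 < sin (4 * u) := fun u hu =>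
    sin_pos_of_pos_of_lt_pi (by linarith [hu.1]) (by linarith [hu.2])
  have hf : ContinuousOn (fun u => 4 * h u / sin (4 * u)) (Ioo 0 (π / 4)) :=
    ContinuousOn.div (by fun_prop) (by fun_prop) fun u hu => (hsin u hu).ne'
  have hp : π / 8 ∈ Ioo (0 : ℝ) (π / 4) := ⟨by linarith, by linarith⟩
  have hbound : ∀ u ∈ Ioo (0 : ℝ) (π / 4), ∀ d, 0 < d → sin (4 * u) ≤ 4 * d →
      min a₁ a₃ / d ≤ 4 * h u / sin (4 * u) := fun u hu d hd hle => by
    rw [← mul_div_mul_left (min a₁ a₃) d (four_ne_zero)]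
    exact div_le_div₀ (by linarith [hlow u]) (by linarith [hlow u]) (hsin u hu) hle
  constructor
  · have hmem : Ioo 0 (π / 4) ∈ nhdsWithin 0 (Ioi 0) := Ioo_mem_nhdsGT (by linarith)
    have hlim := tendsto_integral_nhdsGT_atTop_of_div_sub_le hm hp hf fun u hu =>
      hbound u hu (u - 0) (by linarith [hu.1])
        (by rw [sub_zero]; exact sin_le (by linarith [hu.1]))
    have hFlim : Tendsto F (nhdsWithin 0 (Ioi 0)) atBot := by
      refine (tendsto_neg_atTop_atBot.comp hlim).congr' ?_
      filter_upwards [hmem] with s hs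
      rw [hF s hs, Function.comp_apply, ← intervalIntegral.integral_symm]
    have harg := (tendsto_exp_atBot.comp hFlim).const_mul c
    have hα₀ := ((continuous_arctan.tendsto _).comp harg).const_mul 2
    rw [mul_zero, arctan_zero, mul_zero] at hα₀
    refine hα₀.congr' ?_
    filter_upwards [hmem] with s hs using (hα s hs).symm
  · have hmem : Ioo 0 (π / 4) ∈ nhdsWithin (π / 4) (Iio (π / 4)) :=
      Ioo_mem_nhdsLT (by linarith)
    have hlim := tendsto_integral_nhdsLT_atTop_of_div_sub_le hm hp hf fun u hu =>
      hbound u hu (π / 4 - u) (by linarith [hu.2]) (by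
        rw [← sin_pi_sub]
        exact (sin_le (by linarith [hu.2])).trans (by linarith))
    have hFlim : Tendsto F (nhdsWithin (π / 4) (Iio (π / 4))) atTop := by
      refine hlim.congr' ?_
      filter_upwards [hmem] with s hs using (hF s hs).symm
    have harg := (tendsto_exp_atTop.comp hFlim).const_mul_atTop hc
    have hαπ := ((tendsto_arctan_atTop.mono_right nhdsWithin_le_nhds).comp harg).const_mul 2
    rw [mul_div_cancel₀ π two_ne_zero] at hαπ
    refine hαπ.congr' ?_
    filter_upwards [hmem] with s hs using (hα s hs).symm
end

section
/- (Main Theorem, analytic form.) Let k₁, k₂, k₃, k₄ be nonzero integers and set a_i = |k_i|, h(s) = √(a₁² cos²s + a₂² cos²(s+π/4) + a₃² sin²s + a₄² sin²(s+π/4)). Then there exists a twice differentiable function α : (0,π/4) → ℝ with 0 < α(s) < π, strictly increasing, satisfying simultaneously the horizontal-conformality equation α'(s) = 4 h(s) sin(α(s)) / sin(4s) and the harmonicity equation α''(s) + [4 cos(4s)/sin(4s) − h'(s)/h(s)] α'(s) − (16 h(s)²/sin²(4s)) sin(α(s)) cos(α(s)) = 0 for all s ∈ (0,π/4), and with lim_{s→0⁺}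 α(s) = 0 and lim_{s→(π/4)⁻} α(s) = π. -/
open Real Set Filter

/-- A function continuous on an open interval has a primitive there. -/
theorem exists_hasDerivAt_of_continuousOn_Ioo {a b : ℝ} (hab : a < b) {f : ℝ → ℝ}
    (hf : ContinuousOn f (Ioo a b)) : ∃ F : ℝ → ℝ, ∀ s ∈ Ioo a b, HasDerivAt F (f s) s := by
  have hm : (a + b) / 2 ∈ Ioo a b := ⟨by linarith, by linarith⟩
  refine ⟨fun s => ∫ t in ((a + b) / 2)..s, f t, fun s hs => ?_⟩
  exact intervalIntegral.integral_hasDerivAt_right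
    ((hf.mono (ordConnected_Ioo.uIcc_subset hm hs)).intervalIntegrable)
    (hf.stronglyMeasurableAtFilter isOpen_Ioo s hs) (hf.continuousAt (isOpen_Ioo.mem_nhds hs))

theorem monotoneOn_Ioo_of_hasDerivAt_nonneg {a b : ℝ} {f f' : ℝ → ℝ}
    (hf : ∀ s ∈ Ioo a b, HasDerivAt f (f' s) s) (h0 : ∀ s ∈ Ioo a b, 0 ≤ f' s) :
    MonotoneOn f (Ioo a b) := by
  refine monotoneOn_of_deriv_nonneg (convex_Ioo a b)
    (fun s hs => (hf s hs).continuousAt.continuousWithinAt) ?_ ?_ <;> rw [interior_Ioo]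
  · exact fun s hs => (hf s hs).differentiableAt.differentiableWithinAt
  · exact fun s hs => (hf s hs).deriv ▸ h0 s hs

/-- A function whose derivative dominates `1 / (s - a)` tends to `-∞` at `a`. -/
theorem tendsto_atBot_nhdsGT_of_inv_le_deriv {a b : ℝ} (hab : a < b) {F f : ℝ → ℝ}
    (hF : ∀ s ∈ Ioo a b, HasDerivAt F (f s) s) (hf : ∀ s ∈ Ioo a b, 1 / (s - a) ≤ f s) :
    Tendsto F (nhdsWithin a (Ioi a)) atBot := by
  have hmono : MonotoneOn (fun s => F s - log (s - a)) (Ioo a b) :=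
    monotoneOn_Ioo_of_hasDerivAt_nonneg
      (fun s hs => (hF s hs).sub (((hasDerivAt_id s).sub_const a).log (sub_pos.2 hs.1).ne'))
      (fun s hs => sub_nonneg.2 (hf s hs))
  have hm : (a + b) / 2 ∈ Ioo a b := ⟨by linarith, by linarith⟩
  set m := (a + b) / 2
  have hlim : Tendsto (fun s => log (s - a) + (F m - log (m - a)))
      (nhdsWithin a (Ioi a)) atBot := by
    refine tendsto_atBot_add_const_right _ _ (tendsto_log_nhdsGT_zero.comp ?_)
    refine tendsto_nhdsWithin_iff.2 ⟨?_, ?_⟩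
    · have : Tendsto (fun s : ℝ => s - a) (nhds a) (nhds (a - a)) :=
        (continuous_id.sub continuous_const).tendsto a
      rw [sub_self] at this
      exact this.mono_left nhdsWithin_le_nhds
    · filter_upwards [self_mem_nhdsWithin] with s hs using sub_pos.2 (mem_Ioi.1 hs)
  refine tendsto_atBot_mono' _ ?_ hlim
  filter_upwards [Ioo_mem_nhdsGT hm.1] with s hs
  have := hmono ⟨hs.1, hs.2.trans hm.2⟩ hm hs.2.le
  simp only at this
  linarith

/-- A function whose derivative dominates `1 / (b - s)` tends to `+∞` at `b`. -/
theorem tendsto_atTop_nhdsLT_of_inv_le_deriv {a b : ℝ} (hab : a < b) {F f : ℝ → ℝ}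
    (hF : ∀ s ∈ Ioo a b, HasDerivAt F (f s) s) (hf : ∀ s ∈ Ioo a b, 1 / (b - s) ≤ f s) :
    Tendsto F (nhdsWithin b (Iio b)) atTop := by
  have hreflect : Tendsto (fun s => -F (-s)) (nhdsWithin (-b) (Ioi (-b))) atBot := by
    refine tendsto_atBot_nhdsGT_of_inv_le_deriv (b := -a) (f := fun s => f (-s))
      (neg_lt_neg hab) (fun s hs => ?_) (fun s hs => ?_) <;>
    have hs' : -s ∈ Ioo a b := ⟨by linarith [hs.2], by linarith [hs.1]⟩
    · exact ((hF (-s) hs').comp s (hasDerivAt_neg s)).neg.congr_deriv (by simp)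
    · convert hf (-s) hs' using 2
      ring
  have := tendsto_neg_atBot_atTop.comp (hreflect.comp tendsto_neg_nhdsLT)
  simpa [Function.comp_def] using this

theorem sin_two_mul_arctan (x : ℝ) : sin (2 * arctan x) = 2 * x / (1 + x ^ 2) := by
  have hx : 0 < 1 + x ^ 2 := by positivity
  rw [sin_two_mul, sin_arctan, cos_arctan]
  field_simp
  rw [Real.sq_sqrt hx.le]

theorem hasDerivAt_two_mul_arctan_exp {F : ℝ → ℝ} {F' s : ℝ} (hF : HasDerivAt F F' s) :
    HasDerivAt (fun t => 2 * arctan (exp (F t))) (F' * sin (2 * arctan (exp (F s)))) s := by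
  refine (hF.exp.arctan.const_mul 2).congr_deriv ?_
  rw [sin_two_mul_arctan]
  ring

theorem two_mul_arctan_exp_mem_Ioo (x : ℝ) : 2 * arctan (exp x) ∈ Ioo 0 π :=
  ⟨by linarith [arctan_pos.2 (exp_pos x)], by linarith [arctan_lt_pi_div_two (exp x)]⟩

theorem tendsto_two_mul_arctan_exp_atBot :
    Tendsto (fun x => 2 * arctan (exp x)) atBot (nhds 0) := by
  simpa using ((continuous_arctan.tendsto 0).comp tendsto_exp_atBot).const_mul 2

theorem tendsto_two_mul_arctan_exp_atTop :
    Tendsto (fun x => 2 * arctan (exp x)) atTop (nhds π) := by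
  have := (tendsto_nhds_of_tendsto_nhdsWithin tendsto_arctan_atTop).comp tendsto_exp_atTop
  simpa [Function.comp_def, mul_div_cancel₀] using this.const_mul 2

theorem one_le_abs_intCast_sq {k : ℤ} (hk : k ≠ 0) : 1 ≤ |(k : ℝ)| ^ 2 := by
  rw [sq_abs]
  exact_mod_cast Int.one_le_abs hk |>.trans (by nlinarith [Int.one_le_abs hk, sq_abs k])

/-- Existence for the horizontal-conformality and harmonicity equations with a general
weight `h ≥ 1`. -/
theorem exists_conformal_harmonic_solution {h : ℝ → ℝ} (hd : Differentiable ℝ h)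
    (h1 : ∀ s, 1 ≤ h s) :
    ∃ α α' α'' : ℝ → ℝ,
      (∀ s ∈ Ioo (0 : ℝ) (π / 4),
        HasDerivAt α (α' s) s ∧ HasDerivAt α' (α'' s) s ∧
        0 < α s ∧ α s < π ∧
        α' s = 4 * h s * sin (α s) / sin (4 * s) ∧
        α'' s + (4 * cos (4 * s) / sin (4 * s) - deriv h s / h s) * α' s
          - 16 * (h s) ^ 2 / sin (4 * s) ^ 2 * sin (α s) * cos (α s) = 0) ∧
      StrictMonoOn α (Ioo 0 (π / 4)) ∧
      Tendsto α (nhdsWithin 0 (Ioi 0)) (nhds 0) ∧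
      Tendsto α (nhdsWithin (π / 4) (Iio (π / 4))) (nhds π) := by
  have hpi : (0 : ℝ) < π / 4 := by positivity
  have hsin : ∀ s ∈ Ioo (0 : ℝ) (π / 4), 0 < sin (4 * s) := fun s hs =>
    sin_pos_of_pos_of_lt_pi (by linarith [hs.1]) (by linarith [hs.2])
  have hpos : ∀ s, 0 < h s := fun s => one_pos.trans_le (h1 s)
  obtain ⟨F, hF⟩ := exists_hasDerivAt_of_continuousOn_Ioo (f := fun s => 4 * h s / sin (4 * s)) hpi
    (ContinuousOn.div (continuous_const.mul hd.continuous).continuousOn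
      (by fun_prop) fun s hs => (hsin s hs).ne')
  have hbound : ∀ s ∈ Ioo (0 : ℝ) (π / 4), ∀ d, 0 < d → sin (4 * s) ≤ 4 * d →
      1 / d ≤ 4 * h s / sin (4 * s) := by
    intro s hs d hd0 hle
    rw [div_le_div_iff₀ hd0 (hsin s hs)]
    nlinarith [h1 s]
  have hbot : Tendsto F (nhdsWithin 0 (Ioi 0)) atBot := by
    refine tendsto_atBot_nhdsGT_of_inv_le_deriv hpi hF fun s hs => hbound s hs _ ?_ ?_
    · linarith [hs.1]
    · rw [sub_zero]
      exact sin_le (by linarith [hs.1])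
  have htop : Tendsto F (nhdsWithin (π / 4) (Iio (π / 4))) atTop := by
    refine tendsto_atTop_nhdsLT_of_inv_le_deriv hpi hF fun s hs => hbound s hs _ ?_ ?_
    · linarith [hs.2]
    · rw [← sin_pi_sub]
      exact (sin_le (by linarith [hs.2])).trans_eq (by ring)
  set α : ℝ → ℝ := fun s => 2 * arctan (exp (F s)) with hα
  have hmem : ∀ s, α s ∈ Ioo 0 π := fun s => two_mul_arctan_exp_mem_Ioo (F s)
  have hαd : ∀ s ∈ Ioo (0 : ℝ) (π / 4),
      HasDerivAt α (4 * h s * sin (α s) / sin (4 * s)) s := by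
    intro s hs
    refine (hasDerivAt_two_mul_arctan_exp (hF s hs)).congr_deriv ?_
    ring
  refine ⟨α, fun s => 4 * h s * sin (α s) / sin (4 * s),
    fun s => -((4 * cos (4 * s) / sin (4 * s) - deriv h s / h s)
        * (4 * h s * sin (α s) / sin (4 * s)))
      + 16 * (h s) ^ 2 / sin (4 * s) ^ 2 * sin (α s) * cos (α s),
    fun s hs => ⟨hαd s hs, ?_, (hmem s).1, (hmem s).2, rfl, by ring⟩, ?_,
    tendsto_two_mul_arctan_exp_atBot.comp hbot, tendsto_two_mul_arctan_exp_atTop.comp htop⟩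
  · have hs4 : HasDerivAt (fun t : ℝ => sin (4 * t)) (cos (4 * s) * (4 * 1)) s :=
      ((hasDerivAt_id s).const_mul 4).sin
    have hne := (hsin s hs).ne'
    have hhne := (hpos s).ne'
    refine ((((hd s).hasDerivAt.const_mul 4).mul (hαd s hs).sin).div hs4 hne).congr_deriv ?_
    simp only [Pi.mul_apply]
    field_simp
    ring
  · refine strictMonoOn_of_deriv_pos (convex_Ioo _ _)
      (fun s hs => (hαd s hs).continuousAt.continuousWithinAt) ?_
    rw [interior_Ioo]
    intro s hs
    rw [(hαd s hs).deriv]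
    exact div_pos (mul_pos (mul_pos four_pos (hpos s))
      (sin_pos_of_pos_of_lt_pi (hmem s).1 (hmem s).2)) (hsin s hs)

/-- Main Theorem (analytic form): existence of a solution of both the horizontal-conformality
and the harmonicity equations on `(0, π/4)` with the required boundary behaviour. -/
theorem main_theorem (k₁ k₂ k₃ k₄ : ℤ)
    (hk₁ : k₁ ≠ 0) (hk₂ : k₂ ≠ 0) (hk₃ : k₃ ≠ 0) (hk₄ : k₄ ≠ 0)
    (a₁ a₂ a₃ a₄ : ℝ)
    (ha₁ : a₁ = |(k₁ : ℝ)|) (ha₂ : a₂ = |(k₂ : ℝ)|)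
    (ha₃ : a₃ = |(k₃ : ℝ)|) (ha₄ : a₄ = |(k₄ : ℝ)|)
    (h : ℝ → ℝ)
    (hh : ∀ s : ℝ, h s = Real.sqrt (a₁ ^ 2 * cos s ^ 2 + a₂ ^ 2 * cos (s + π / 4) ^ 2
      + a₃ ^ 2 * sin s ^ 2 + a₄ ^ 2 * sin (s + π / 4) ^ 2)) :
    ∃ α α' α'' : ℝ → ℝ,
      (∀ s ∈ Ioo (0 : ℝ) (π / 4),
        HasDerivAt α (α' s) s ∧ HasDerivAt α' (α'' s) s ∧
        0 < α s ∧ α s < π ∧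
        α' s = 4 * h s * sin (α s) / sin (4 * s) ∧
        α'' s + (4 * cos (4 * s) / sin (4 * s) - deriv h s / h s) * α' s
          - 16 * (h s) ^ 2 / sin (4 * s) ^ 2 * sin (α s) * cos (α s) = 0) ∧
      StrictMonoOn α (Ioo 0 (π / 4)) ∧
      Tendsto α (nhdsWithin 0 (Ioi 0)) (nhds 0) ∧
      Tendsto α (nhdsWithin (π / 4) (Iio (π / 4))) (nhds π) := by
  have h1 : ∀ s : ℝ, 1 ≤ a₁ ^ 2 * cos s ^ 2 + a₂ ^ 2 * cos (s + π / 4) ^ 2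
      + a₃ ^ 2 * sin s ^ 2 + a₄ ^ 2 * sin (s + π / 4) ^ 2 := by
    intro s
    have b₁ : 1 ≤ a₁ ^ 2 := ha₁ ▸ one_le_abs_intCast_sq hk₁
    have b₃ : 1 ≤ a₃ ^ 2 := ha₃ ▸ one_le_abs_intCast_sq hk₃
    have c₁ := mul_le_mul_of_nonneg_right b₁ (sq_nonneg (cos s))
    have c₃ := mul_le_mul_of_nonneg_right b₃ (sq_nonneg (sin s))
    have c₂ : 0 ≤ a₂ ^ 2 * cos (s + π / 4) ^ 2 := by positivity
    have c₄ : 0 ≤ a₄ ^ 2 * sin (s + π / 4) ^ 2 := by positivity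
    linarith [sin_sq_add_cos_sq s]
  obtain rfl : h = _ := funext hh
  refine exists_conformal_harmonic_solution ?_ fun s => Real.one_le_sqrt.2 (h1 s)
  exact Differentiable.sqrt (by fun_prop) fun s => (one_pos.trans_le (h1 s)).ne'
end

section
/- Let a₁, a₂, a₃, a₄ be positive real numbers, define h(s) = √(a₁² cos²s + a₂² cos²(s+π/4) + a₃² sin²s + a₄² sin²(s+π/4)), and for s ∈ (π/4,π/2) set F₂(s) = ∫_{3π/8}^{s} 4 h(u)/sin(4u) du. For every constant c > 0, the function α(s) = 2π + 2 arctan(−c·exp(F₂(s))) satisfies π < α(s) < 2π and α'(s) = 4 h(s) sin(α(s)) / sin(4s) for every s ∈ (π/4,π/2), and lim_{s→(π/4)⁺} α(s) = π and lim_{s→(π/2)⁻} α(s) = 2π. -/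
open Real Set Filter

theorem tendsto_atTop_nhdsGT_of_hasDerivAt_le {F f : ℝ → ℝ} {a b m : ℝ} (hab : a < b) (hm : 0 < m)
    (hF : ∀ x ∈ Ioo a b, HasDerivAt F (f x) x) (hf : ∀ x ∈ Ioo a b, f x ≤ -(m / (x - a))) :
    Tendsto F (nhdsWithin a (Ioi a)) atTop := by
  obtain ⟨d, had, hdb⟩ := exists_between hab
  have hG : ∀ x ∈ Ioo a b,
      HasDerivAt (fun y => F y + m * log (y - a)) (f x + m * (1 / (x - a))) x := fun x hx =>
    (hF x hx).add ((((hasDerivAt_id x).sub_const a).log (sub_pos.2 hx.1).ne').const_mul m)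
  have hanti : AntitoneOn (fun y => F y + m * log (y - a)) (Ioo a b) := by
    refine antitoneOn_of_deriv_nonpos (convex_Ioo a b)
      (fun x hx => (hG x hx).continuousAt.continuousWithinAt) ?_ ?_
    · rw [interior_Ioo]
      exact fun x hx => (hG x hx).differentiableAt.differentiableWithinAt
    · rw [interior_Ioo]
      intro x hx
      rw [(hG x hx).deriv, mul_one_div]
      linarith [hf x hx]
  have hsub : Tendsto (fun x => x - a) (nhdsWithin a (Ioi a)) (nhdsWithin 0 (Ioi 0)) := by
    refine tendsto_nhdsWithin_iff.2 ⟨?_, ?_⟩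
    · have : Tendsto (fun x => x - a) (nhds a) (nhds (a - a)) :=
        (continuous_id.sub continuous_const).tendsto a
      rw [sub_self] at this
      exact this.mono_left nhdsWithin_le_nhds
    · filter_upwards [self_mem_nhdsWithin] with x hx
      exact sub_pos.2 (mem_Ioi.1 hx)
  have hlog := ((tendsto_log_nhdsGT_zero.comp hsub).const_mul_atBot hm)
  have htop := tendsto_atTop_add_const_left _ (F d + m * log (d - a))
    (tendsto_neg_atBot_atTop.comp hlog)
  refine tendsto_atTop_mono' _ ?_ htop
  filter_upwards [Ioo_mem_nhdsGT had] with x hx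
  have := hanti ⟨hx.1, hx.2.trans hdb⟩ ⟨had, hdb⟩ hx.2.le
  simp only [Function.comp_apply] at this ⊢
  linarith

theorem tendsto_atBot_nhdsLT_of_hasDerivAt_le {F f : ℝ → ℝ} {a b m : ℝ} (hab : a < b) (hm : 0 < m)
    (hF : ∀ x ∈ Ioo a b, HasDerivAt F (f x) x) (hf : ∀ x ∈ Ioo a b, f x ≤ -(m / (b - x))) :
    Tendsto F (nhdsWithin b (Iio b)) atBot := by
  have hmem : ∀ x ∈ Ioo (-b) (-a), -x ∈ Ioo a b := fun x hx =>
    ⟨by linarith [hx.2], by linarith [hx.1]⟩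
  have key : Tendsto (fun x => -F (-x)) (nhdsWithin (-b) (Ioi (-b))) atTop := by
    refine tendsto_atTop_nhdsGT_of_hasDerivAt_le (f := fun x => f (-x)) (neg_lt_neg hab) hm
      (fun x hx => ?_) (fun x hx => ?_)
    · exact ((hF (-x) (hmem x hx)).comp x (hasDerivAt_neg x)).neg.congr_deriv (by ring)
    · have := hf (-x) (hmem x hx)
      rwa [show b - -x = x - -b by ring] at this
  have h := tendsto_neg_atTop_atBot.comp (key.comp (tendsto_neg_nhdsLT (a := b)))
  simpa [Function.comp_def] using h

theorem min_le_sqrt_add_sq {a b x r : ℝ} (ha : 0 < a) (hb : 0 < b)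
    (hr : a ^ 2 * cos x ^ 2 + b ^ 2 * sin x ^ 2 ≤ r) : min a b ≤ √r := by
  have hm : 0 < min a b := lt_min ha hb
  have h1 : min a b ^ 2 ≤ a ^ 2 := by gcongr; exact min_le_left a b
  have h2 : min a b ^ 2 ≤ b ^ 2 := by gcongr; exact min_le_right a b
  refine le_sqrt_of_sq_le (le_trans ?_ hr)
  nlinarith [sin_sq_add_cos_sq x, mul_le_mul_of_nonneg_right h1 (sq_nonneg (cos x)),
    mul_le_mul_of_nonneg_right h2 (sq_nonneg (sin x))]

theorem sin_four_mul_neg {x : ℝ} (hx : x ∈ Ioo (π / 4) (π / 2)) : sin (4 * x) < 0 := by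
  have := sin_pos_of_pos_of_lt_pi (x := 4 * x - π) (by linarith [hx.1]) (by linarith [hx.2])
  rw [sin_sub_pi] at this
  linarith

theorem four_mul_div_sin_le {m y x d : ℝ} (hm : 0 ≤ m) (hy : m ≤ y) (hs : sin (4 * x) < 0)
    (hd : -sin (4 * x) ≤ 4 * d) : 4 * y / sin (4 * x) ≤ -(m / d) := by
  have hd0 : 0 < d := by linarith
  rw [← neg_neg (sin (4 * x)), div_neg, neg_le_neg_iff, div_le_div_iff₀ hd0 (by linarith)]
  nlinarith

theorem hasDerivAt_two_pi_add_two_mul_arctan {F : ℝ → ℝ} {k y s c : ℝ}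
    (hF : HasDerivAt F (k / y) s) :
    HasDerivAt (fun t => 2 * π + 2 * arctan (-c * Real.exp (F t)))
      (k * sin (2 * π + 2 * arctan (-c * Real.exp (F s))) / y) s := by
  have hsin : ∀ x : ℝ, sin (2 * π + 2 * arctan x) = 2 * x / (1 + x ^ 2) := fun x => by
    have hsq : √(1 + x ^ 2) * √(1 + x ^ 2) = 1 + x ^ 2 := mul_self_sqrt (by positivity)
    rw [add_comm, sin_add_two_pi, sin_two_mul, sin_arctan, cos_arctan, mul_assoc, div_mul_div_comm,
      hsq, mul_one, mul_div_assoc]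
  refine ((((hF.exp.const_mul (-c)).arctan).const_mul 2).const_add (2 * π)).congr_deriv ?_
  rw [hsin]
  ring

theorem second_interval_solutions (a₁ a₂ a₃ a₄ : ℝ)
    (ha₁ : 0 < a₁) (ha₂ : 0 < a₂) (ha₃ : 0 < a₃) (ha₄ : 0 < a₄)
    (h : ℝ → ℝ)
    (hh : ∀ s : ℝ, h s = Real.sqrt (a₁ ^ 2 * cos s ^ 2 + a₂ ^ 2 * cos (s + π / 4) ^ 2
      + a₃ ^ 2 * sin s ^ 2 + a₄ ^ 2 * sin (s + π / 4) ^ 2))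
    (F₂ : ℝ → ℝ)
    (hF₂ : ∀ s ∈ Ioo (π / 4) (π / 2), F₂ s = ∫ u in (3 * π / 8)..s, 4 * h u / sin (4 * u))
    (c : ℝ) (hc : 0 < c)
    (α : ℝ → ℝ)
    (hα : ∀ s ∈ Ioo (π / 4) (π / 2), α s = 2 * π + 2 * arctan (-c * Real.exp (F₂ s))) :
    (∀ s ∈ Ioo (π / 4) (π / 2),
      π < α s ∧ α s < 2 * π ∧ HasDerivAt α (4 * h s * sin (α s) / sin (4 * s)) s) ∧
    Tendsto α (nhdsWithin (π / 4) (Ioi (π / 4))) (nhds π) ∧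
    Tendsto α (nhdsWithin (π / 2) (Iio (π / 2))) (nhds (2 * π)) := by
  have hcont : Continuous h := by
    rw [funext hh]
    fun_prop
  have hmin : 0 < min a₁ a₃ := lt_min ha₁ ha₃
  have hle : ∀ s, min a₁ a₃ ≤ h s := fun s => by
    rw [hh]
    refine min_le_sqrt_add_sq (x := s) ha₁ ha₃ ?_
    nlinarith [sq_nonneg (a₂ * cos (s + π / 4)), sq_nonneg (a₄ * sin (s + π / 4))]
  have hlt : π / 4 < π / 2 := by linarith [pi_pos]
  have hmid : 3 * π / 8 ∈ Ioo (π / 4) (π / 2) :=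
    ⟨by linarith [pi_pos], by linarith [pi_pos]⟩
  have hfc : ContinuousOn (fun u => 4 * h u / sin (4 * u)) (Ioo (π / 4) (π / 2)) :=
    ContinuousOn.div (by fun_prop) (by fun_prop) fun x hx => (sin_four_mul_neg hx).ne
  have hF : ∀ s ∈ Ioo (π / 4) (π / 2), HasDerivAt F₂ (4 * h s / sin (4 * s)) s := fun s hs => by
    refine HasDerivAt.congr_of_eventuallyEq ?_
      (eventually_of_mem (isOpen_Ioo.mem_nhds hs) hF₂)
    exact intervalIntegral.integral_hasDerivAt_right
      ((hfc.mono (ordConnected_Ioo.uIcc_subset hmid hs)).intervalIntegrable)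
      (hfc.stronglyMeasurableAtFilter isOpen_Ioo s hs)
      (hfc.continuousAt (isOpen_Ioo.mem_nhds hs))
  have htop : Tendsto F₂ (nhdsWithin (π / 4) (Ioi (π / 4))) atTop :=
    tendsto_atTop_nhdsGT_of_hasDerivAt_le hlt hmin hF fun x hx =>
      four_mul_div_sin_le hmin.le (hle x) (sin_four_mul_neg hx) (by
        have := sin_le (x := 4 * x - π) (by linarith [hx.1])
        rw [sin_sub_pi] at this
        linarith)
  have hbot : Tendsto F₂ (nhdsWithin (π / 2) (Iio (π / 2))) atBot :=
    tendsto_atBot_nhdsLT_of_hasDerivAt_le hlt hmin hF fun x hx =>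
      four_mul_div_sin_le hmin.le (hle x) (sin_four_mul_neg hx) (by
        have := sin_le (x := 2 * π - 4 * x) (by linarith [hx.2])
        rw [sin_two_pi_sub] at this
        linarith)
  refine ⟨fun s hs => ⟨?_, ?_, ?_⟩, ?_, ?_⟩
  · rw [hα s hs]
    linarith [neg_pi_div_two_lt_arctan (-c * Real.exp (F₂ s))]
  · have : arctan (-c * Real.exp (F₂ s)) < 0 :=
      arctan_lt_zero.2 (mul_neg_of_neg_of_pos (neg_lt_zero.2 hc) (exp_pos _))
    rw [hα s hs]
    linarith
  · rw [hα s hs]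
    exact (hasDerivAt_two_pi_add_two_mul_arctan (hF s hs)).congr_of_eventuallyEq
      (eventually_of_mem (isOpen_Ioo.mem_nhds hs) hα)
  · have hlim : Tendsto (fun s => 2 * π + 2 * arctan (-c * Real.exp (F₂ s)))
        (nhdsWithin (π / 4) (Ioi (π / 4))) (nhds (2 * π + 2 * (-(π / 2)))) :=
      (((tendsto_nhds_of_tendsto_nhdsWithin tendsto_arctan_atBot).comp
        ((tendsto_exp_atTop.comp htop).const_mul_atTop_of_neg (neg_lt_zero.2 hc))).const_mul
          2).const_add (2 * π)
    rw [show 2 * π + 2 * (-(π / 2)) = π by ring] at hlim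
    exact hlim.congr' (eventually_of_mem (Ioo_mem_nhdsGT hlt) fun s hs => (hα s hs).symm)
  · have hlim : Tendsto (fun s => 2 * π + 2 * arctan (-c * Real.exp (F₂ s)))
        (nhdsWithin (π / 2) (Iio (π / 2))) (nhds (2 * π + 2 * arctan (-c * 0))) :=
      (((continuous_arctan.tendsto _).comp
        ((tendsto_exp_atBot.comp hbot).const_mul (-c))).const_mul 2).const_add (2 * π)
    rw [mul_zero, arctan_zero, mul_zero, add_zero] at hlim
    exact hlim.congr' (eventually_of_mem (Ioo_mem_nhdsLT hlt) fun s hs => (hα s hs).symm)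
end

section
/- (Corollary, analytic form.) Let k₁, k₂, k₃, k₄ be nonzero integers, set a_i = |k_i| and h(s) = √(a₁² cos²s + a₂² cos²(s+π/4) + a₃² sin²s + a₄² sin²(s+π/4)), and let I = (0,π/4) ∪ (π/4,π/2) ∪ (π/2,3π/4) ∪ (3π/4,π). Then there exists a twice differentiable function α : I → ℝ with 0 < α(s) < 4π, satisfying α'(s) = 4 h(s) sin(α(s)) / sin(4s) and α''(s) + [4 cos(4s)/sin(4s) − h'(s)/h(s)] α'(s) − (16 h(s)²/sin²(4s)) sin(α(s)) cos(α(s)) = 0 for all s ∈ I, and with the boundary limits: α(s) → 0 as s → 0⁺, α(s) → π as s → (π/4)⁻ and as s → (π/4)⁺, α(s) → 2π as s → (π/2)⁻ and as s → (π/2)⁺, α(s) → 3π as s → (3π/4)⁻ and as s → (3π/4)⁺, and α(s) → 4π as s → π⁻. -/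
open Real Set Filter

/-- A continuous function bounded below by `1` has a primitive that exhausts the real line. -/
theorem exists_primitive_tendsto {k : ℝ → ℝ} (hk : Continuous k) (hk1 : ∀ u, 1 ≤ k u) :
    ∃ K : ℝ → ℝ, (∀ u, HasDerivAt K (k u) u) ∧ Tendsto K atTop atTop ∧
      Tendsto K atBot atBot := by
  have hK : ∀ u, HasDerivAt (fun u => ∫ v in (0 : ℝ)..u, k v) (k u) u := fun u =>
    intervalIntegral.integral_hasDerivAt_right (hk.intervalIntegrable _ _)
      hk.stronglyMeasurable.stronglyMeasurableAtFilter hk.continuousAt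
  have hmono : Monotone fun u => (∫ v in (0 : ℝ)..u, k v) - u := by
    have hd : ∀ u, HasDerivAt (fun u => (∫ v in (0 : ℝ)..u, k v) - u) (k u - 1) u :=
      fun u => (hK u).sub (hasDerivAt_id u)
    refine monotone_of_deriv_nonneg (fun u => (hd u).differentiableAt) fun u => ?_
    rw [(hd u).deriv]
    linarith [hk1 u]
  refine ⟨_, hK, ?_, ?_⟩
  · refine tendsto_atTop_mono' _ ?_ tendsto_id
    filter_upwards [eventually_ge_atTop 0] with u hu
    simpa using hmono hu
  · refine tendsto_atBot_mono' _ ?_ tendsto_id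
    filter_upwards [eventually_le_atBot 0] with u hu
    simpa using hmono hu

/-- For `g ≥ 1` continuous, the equation `β' = 4 g sin β / sin (4t)` has a solution on `(0, π/4)`
increasing from `0` to `π`. -/
theorem exists_solution_Ioo_zero {g : ℝ → ℝ} (hg : Continuous g) (hg1 : ∀ t, 1 ≤ g t) :
    ∃ β : ℝ → ℝ,
      (∀ t ∈ Ioo 0 (π / 4), HasDerivAt β (4 * g t * sin (β t) / sin (4 * t)) t) ∧
      (∀ t, 0 < β t ∧ β t < π) ∧
      Tendsto β (nhdsWithin 0 (Ioi 0)) (nhds 0) ∧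
      Tendsto β (nhdsWithin (π / 4) (Iio (π / 4))) (nhds π) := by
  obtain ⟨K, hK, hKtop, hKbot⟩ := exists_primitive_tendsto
    (k := fun u => g (arctan (exp u) / 2)) (by fun_prop) (fun u => hg1 _)
  refine ⟨fun t => 2 * arctan (exp (K (log (tan (2 * t))))), ?_, fun t => ?_, ?_, ?_⟩
  · rintro t ⟨ht0, ht1⟩
    have hs : 0 < sin (2 * t) := sin_pos_of_pos_of_lt_pi (by linarith) (by linarith)
    have hc : 0 < cos (2 * t) := cos_pos_of_mem_Ioo ⟨by linarith, by linarith⟩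
    have htan : 0 < tan (2 * t) := by rw [tan_eq_sin_div_cos]; positivity
    have hinv : arctan (exp (log (tan (2 * t)))) / 2 = t := by
      rw [exp_log htan, arctan_tan (by linarith) (by linarith)]; ring
    have hKt := hK (log (tan (2 * t)))
    rw [hinv] at hKt
    have hlin : HasDerivAt (fun t : ℝ => 2 * t) 2 t := by
      simpa using (hasDerivAt_id t).const_mul (2 : ℝ)
    have hlog := ((hasDerivAt_tan hc.ne').comp t hlin).log htan.ne'
    have hβ := ((hKt.comp t hlog).exp.arctan).const_mul (2 : ℝ)
    refine hβ.congr_deriv ?_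
    simp only [Function.comp_apply]
    have hsin : ∀ x : ℝ, sin (2 * arctan x) = 2 * x / (1 + x ^ 2) := fun x => by
      have hx : 0 < 1 + x ^ 2 := by positivity
      rw [sin_two_mul, sin_arctan, cos_arctan, mul_div_assoc', mul_one, mul_div_assoc',
        div_div, mul_self_sqrt hx.le]
    rw [hsin, show 4 * t = 2 * (2 * t) by ring, sin_two_mul, tan_eq_sin_div_cos]
    field_simp
    ring
  · have h0 := arctan_pos.2 (exp_pos (K (log (tan (2 * t)))))
    have h1 := arctan_lt_pi_div_two (exp (K (log (tan (2 * t)))))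
    constructor <;> linarith
  · have htan : Tendsto (fun t => tan (2 * t)) (nhdsWithin 0 (Ioi 0)) (nhdsWithin 0 (Ioi 0)) := by
      refine tendsto_nhdsWithin_iff.2 ⟨?_, ?_⟩
      · have hc : ContinuousAt (fun t : ℝ => tan (2 * t)) 0 :=
          ContinuousAt.comp (g := tan) (continuousAt_tan.2 (by simp)) (by fun_prop)
        simpa [ContinuousAt] using hc.tendsto.mono_left nhdsWithin_le_nhds
      · filter_upwards [Ioo_mem_nhdsGT (show (0 : ℝ) < π / 4 by positivity)] with t ht
        exact tan_pos_of_pos_of_lt_pi_div_two (by linarith [ht.1]) (by linarith [ht.2])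
    have hexp := tendsto_exp_atBot.comp (hKbot.comp (tendsto_log_nhdsGT_zero.comp htan))
    simpa using ((continuous_arctan.tendsto 0).comp hexp).const_mul 2
  · have hlin : Tendsto (fun t : ℝ => 2 * t) (nhdsWithin (π / 4) (Iio (π / 4)))
        (nhdsWithin (π / 2) (Iio (π / 2))) := by
      refine tendsto_nhdsWithin_iff.2 ⟨?_, ?_⟩
      · have hc : Continuous fun t : ℝ => 2 * t := by fun_prop
        have := (hc.tendsto (π / 4)).mono_left (nhdsWithin_le_nhds (s := Iio (π / 4)))
        rwa [show 2 * (π / 4) = π / 2 by ring] at this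
      · filter_upwards [self_mem_nhdsWithin] with t ht
        simp only [mem_Iio] at ht ⊢
        linarith
    have hexp := tendsto_exp_atTop.comp
      (hKtop.comp (tendsto_log_atTop.comp (tendsto_tan_pi_div_two.comp hlin)))
    have harc := (tendsto_arctan_atTop.mono_right nhdsWithin_le_nhds).comp hexp
    have := harc.const_mul 2
    rwa [mul_div_cancel₀ π two_ne_zero] at this

/-- For `h ≥ 1` continuous, the equation `β' = 4 h sin β / sin (4s)` has a solution on
`(mπ/4, (m+1)π/4)` increasing from `mπ` to `(m+1)π`. -/
theorem exists_solution_Ioo {h : ℝ → ℝ} (hc : Continuous h) (h1 : ∀ s, 1 ≤ h s) (m : ℤ) :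
    ∃ β : ℝ → ℝ,
      (∀ s ∈ Ioo (m * π / 4) ((m + 1) * π / 4),
        HasDerivAt β (4 * h s * sin (β s) / sin (4 * s)) s) ∧
      (∀ s, m * π < β s ∧ β s < (m + 1) * π) ∧
      Tendsto β (nhdsWithin (m * π / 4) (Ioi (m * π / 4))) (nhds (m * π)) ∧
      Tendsto β (nhdsWithin ((m + 1) * π / 4) (Iio ((m + 1) * π / 4)))
        (nhds ((m + 1) * π)) := by
  obtain ⟨β, hβ, hb, hl, hr⟩ := exists_solution_Ioo_zero
    (g := fun t => h (t + m * π / 4)) (by fun_prop) (fun t => h1 _)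
  have hshift : Continuous fun s : ℝ => s - m * π / 4 := by fun_prop
  refine ⟨fun s => β (s - m * π / 4) + m * π, fun s hs => ?_, fun s => ?_, ?_, ?_⟩
  · have ht : s - m * π / 4 ∈ Ioo 0 (π / 4) := ⟨by linarith [hs.1], by linarith [hs.2]⟩
    refine (((hβ _ ht).comp_sub_const s (m * π / 4)).add_const (m * π)).congr_deriv ?_
    have hm : ((-1 : ℝ) ^ m) ≠ 0 := zpow_ne_zero _ (by norm_num)
    rw [sin_add_int_mul_pi, show 4 * s = 4 * (s - m * π / 4) + m * π by ring,
      sin_add_int_mul_pi, sub_add_cancel, mul_left_comm, mul_div_mul_left _ _ hm]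
  · constructor <;> linarith [(hb (s - m * π / 4)).1, (hb (s - m * π / 4)).2]
  · have hlin : Tendsto (fun s : ℝ => s - m * π / 4)
        (nhdsWithin (m * π / 4) (Ioi (m * π / 4))) (nhdsWithin 0 (Ioi 0)) := by
      refine tendsto_nhdsWithin_iff.2 ⟨?_, ?_⟩
      · simpa using (hshift.tendsto (m * π / 4)).mono_left nhdsWithin_le_nhds
      · filter_upwards [self_mem_nhdsWithin] with s hs
        simpa using hs
    simpa using (hl.comp hlin).add_const (m * π)
  · have hlin : Tendsto (fun s : ℝ => s - m * π / 4)
        (nhdsWithin ((m + 1) * π / 4) (Iio ((m + 1) * π / 4)))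
        (nhdsWithin (π / 4) (Iio (π / 4))) := by
      refine tendsto_nhdsWithin_iff.2 ⟨?_, ?_⟩
      · have := (hshift.tendsto ((m + 1) * π / 4)).mono_left
          (nhdsWithin_le_nhds (s := Iio ((m + 1) * π / 4)))
        rwa [show (m + 1) * π / 4 - m * π / 4 = π / 4 by ring] at this
      · filter_upwards [self_mem_nhdsWithin] with s hs
        simp only [mem_Iio] at hs ⊢
        linarith
    have := (hr.comp hlin).add_const (m * π)
    rwa [show π + m * π = (m + 1) * π by ring] at this

theorem floor_four_mul_div_pi {m : ℤ} {s : ℝ} (hs : s ∈ Ioo (m * π / 4) ((m + 1) * π / 4)) :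
    ⌊4 * s / π⌋ = m := by
  rw [Int.floor_eq_iff, le_div_iff₀ pi_pos, div_lt_iff₀ pi_pos]
  constructor <;> linarith [hs.1, hs.2]

/-- The solutions on the intervals `(mπ/4, (m+1)π/4)` glue to a single function. -/
theorem exists_glued_solution {h : ℝ → ℝ} (hc : Continuous h) (h1 : ∀ s, 1 ≤ h s) :
    ∃ α : ℝ → ℝ, ∀ m : ℤ,
      (∀ s ∈ Ioo (m * π / 4) ((m + 1) * π / 4),
        HasDerivAt α (4 * h s * sin (α s) / sin (4 * s)) s ∧
        m * π < α s ∧ α s < (m + 1) * π) ∧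
      Tendsto α (nhdsWithin (m * π / 4) (Ioi (m * π / 4))) (nhds (m * π)) ∧
      Tendsto α (nhdsWithin ((m + 1) * π / 4) (Iio ((m + 1) * π / 4)))
        (nhds ((m + 1) * π)) := by
  choose β hβ hb hl hr using exists_solution_Ioo hc h1
  refine ⟨fun s => β ⌊4 * s / π⌋ s, fun m => ?_⟩
  have hlt : m * π / 4 < (m + 1) * π / 4 := by linarith [pi_pos]
  have heq : ∀ s ∈ Ioo (m * π / 4) ((m + 1) * π / 4), β m s = β ⌊4 * s / π⌋ s := fun s hs => by
    rw [floor_four_mul_div_pi hs]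
  refine ⟨fun s hs => ?_, (hl m).congr' ?_, (hr m).congr' ?_⟩
  · simp only [← heq s hs]
    refine ⟨(hβ m s hs).congr_of_eventuallyEq ?_, hb m s⟩
    filter_upwards [isOpen_Ioo.mem_nhds hs] with x hx using (heq x hx).symm
  · filter_upwards [Ioo_mem_nhdsGT hlt] with x hx using heq x hx
  · filter_upwards [Ioo_mem_nhdsLT hlt] with x hx using heq x hx

theorem sin_four_mul_ne_zero {m : ℤ} {s : ℝ} (hs : s ∈ Ioo (m * π / 4) ((m + 1) * π / 4)) :
    sin (4 * s) ≠ 0 := by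
  rw [show 4 * s = 4 * (s - m * π / 4) + m * π by ring, sin_add_int_mul_pi]
  exact mul_ne_zero (zpow_ne_zero _ (by norm_num))
    (sin_pos_of_pos_of_lt_pi (by linarith [hs.1]) (by linarith [hs.2])).ne'

/-- Corollary (analytic form): existence of a solution of the horizontal-conformality
and harmonicity equations on the four open intervals of `I`, with the eight boundary
limits ensuring a continuous extension to the whole variety `V*⁵`. -/
theorem corollary_V5 (k₁ k₂ k₃ k₄ : ℤ)
    (hk₁ : k₁ ≠ 0) (hk₂ : k₂ ≠ 0) (hk₃ : k₃ ≠ 0) (hk₄ : k₄ ≠ 0)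
    (a₁ a₂ a₃ a₄ : ℝ)
    (ha₁ : a₁ = |(k₁ : ℝ)|) (ha₂ : a₂ = |(k₂ : ℝ)|)
    (ha₃ : a₃ = |(k₃ : ℝ)|) (ha₄ : a₄ = |(k₄ : ℝ)|)
    (h : ℝ → ℝ)
    (hh : ∀ s : ℝ, h s = Real.sqrt (a₁ ^ 2 * cos s ^ 2 + a₂ ^ 2 * cos (s + π / 4) ^ 2
      + a₃ ^ 2 * sin s ^ 2 + a₄ ^ 2 * sin (s + π / 4) ^ 2)) :
    ∃ α α' α'' : ℝ → ℝ,
      (∀ s ∈ (Ioo (0 : ℝ) (π / 4) ∪ Ioo (π / 4) (π / 2)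
          ∪ Ioo (π / 2) (3 * π / 4) ∪ Ioo (3 * π / 4) π),
        HasDerivAt α (α' s) s ∧ HasDerivAt α' (α'' s) s ∧
        0 < α s ∧ α s < 4 * π ∧
        α' s = 4 * h s * sin (α s) / sin (4 * s) ∧
        α'' s + (4 * cos (4 * s) / sin (4 * s) - deriv h s / h s) * α' s
          - 16 * (h s) ^ 2 / sin (4 * s) ^ 2 * sin (α s) * cos (α s) = 0) ∧
      Tendsto α (nhdsWithin 0 (Ioi 0)) (nhds 0) ∧
      Tendsto α (nhdsWithin (π / 4) (Iio (π / 4))) (nhds π) ∧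
      Tendsto α (nhdsWithin (π / 4) (Ioi (π / 4))) (nhds π) ∧
      Tendsto α (nhdsWithin (π / 2) (Iio (π / 2))) (nhds (2 * π)) ∧
      Tendsto α (nhdsWithin (π / 2) (Ioi (π / 2))) (nhds (2 * π)) ∧
      Tendsto α (nhdsWithin (3 * π / 4) (Iio (3 * π / 4))) (nhds (3 * π)) ∧
      Tendsto α (nhdsWithin (3 * π / 4) (Ioi (3 * π / 4))) (nhds (3 * π)) ∧
      Tendsto α (nhdsWithin π (Iio π)) (nhds (4 * π)) := by
  have hsq : ∀ {k : ℤ}, k ≠ 0 → (1 : ℝ) ≤ |(k : ℝ)| ^ 2 := fun {k} hk => by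
    have : (1 : ℤ) ≤ |k| := Int.one_le_abs hk
    have : (1 : ℝ) ≤ |(k : ℝ)| := by exact_mod_cast this
    nlinarith
  have hr1 : ∀ s, 1 ≤ a₁ ^ 2 * cos s ^ 2 + a₂ ^ 2 * cos (s + π / 4) ^ 2
      + a₃ ^ 2 * sin s ^ 2 + a₄ ^ 2 * sin (s + π / 4) ^ 2 := fun s => by
    have e₁ : 1 ≤ a₁ ^ 2 := ha₁ ▸ hsq hk₁
    have e₃ : 1 ≤ a₃ ^ 2 := ha₃ ▸ hsq hk₃
    nlinarith [sin_sq_add_cos_sq s, mul_nonneg (sub_nonneg.2 e₁) (sq_nonneg (cos s)),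
      mul_nonneg (sub_nonneg.2 e₃) (sq_nonneg (sin s)), sq_nonneg (a₂ * cos (s + π / 4)),
      sq_nonneg (a₄ * sin (s + π / 4))]
  have h1 : ∀ s, 1 ≤ h s := fun s => by rw [hh]; exact one_le_sqrt.2 (hr1 s)
  have hd : Differentiable ℝ h := by
    rw [funext hh]
    exact Differentiable.sqrt (by fun_prop) fun s => (zero_lt_one.trans_le (hr1 s)).ne'
  obtain ⟨α, hα⟩ := exists_glued_solution hd.continuous h1
  have hI : ∀ s ∈ (Ioo (0 : ℝ) (π / 4) ∪ Ioo (π / 4) (π / 2)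
      ∪ Ioo (π / 2) (3 * π / 4) ∪ Ioo (3 * π / 4) π),
      ∃ m : ℤ, 0 ≤ m ∧ m ≤ 3 ∧ s ∈ Ioo (m * π / 4) ((m + 1) * π / 4) := by
    rintro s (((hs | hs) | hs) | hs)
    · exact ⟨0, by norm_num, by norm_num, by push_cast; constructor <;> linarith [hs.1, hs.2]⟩
    · exact ⟨1, by norm_num, by norm_num, by push_cast; constructor <;> linarith [hs.1, hs.2]⟩
    · exact ⟨2, by norm_num, by norm_num, by push_cast; constructor <;> linarith [hs.1, hs.2]⟩
    · exact ⟨3, by norm_num, by norm_num, by push_cast; constructor <;> linarith [hs.1, hs.2]⟩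
  refine ⟨α, fun s => 4 * h s * sin (α s) / sin (4 * s), fun s =>
    ((4 * deriv h s * sin (α s)
      + 4 * h s * (cos (α s) * (4 * h s * sin (α s) / sin (4 * s)))) * sin (4 * s)
      - 4 * h s * sin (α s) * (cos (4 * s) * 4)) / sin (4 * s) ^ 2, fun s hs => ?_, ?_⟩
  · obtain ⟨m, hm0, hm3, hs⟩ := hI s hs
    obtain ⟨hder, hlo, hhi⟩ := (hα m).1 s hs
    have hne := sin_four_mul_ne_zero hs
    have hm0 : (0 : ℝ) ≤ m := by exact_mod_cast hm0
    have hm3 : (m : ℝ) ≤ 3 := by exact_mod_cast hm3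
    have hpos : 0 < h s := zero_lt_one.trans_le (h1 s)
    have hlin : HasDerivAt (fun s : ℝ => 4 * s) 4 s := by
      simpa using (hasDerivAt_id s).const_mul (4 : ℝ)
    refine ⟨hder, (((hd s).hasDerivAt.const_mul 4).mul hder.sin).div hlin.sin hne,
      by nlinarith [pi_pos], by nlinarith [pi_pos], rfl, ?_⟩
    field_simp
    ring
  · have e₀ := hα 0
    have e₁ := hα 1
    have e₂ := hα 2
    have e₃ := hα 3
    norm_num at e₀ e₁ e₂ e₃
    rw [show 2 * π / 4 = π / 2 by ring] at e₁ e₂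
    exact ⟨e₀.2.1, e₀.2.2, e₁.2.1, e₁.2.2, e₂.2.1, e₂.2.2, e₃.2.1, e₃.2.2⟩
end
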